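/- Let p be a prime with p > 5, let z = z(p) be the entry point of p in the Fibonacci sequence, and assume z is odd. Let k = k(p) be the Pisano period of p. Then the set {F_n : n ∈ ℕ} of Fibonacci quaternions in H[Z_p] contains exactly 4 zero divisors and exactly k − 4 units. -/

import Mathlib

open Quaternion

/-- The n-th Fibonacci quaternion over a commutative ring `R`:
`F_n = f_n + f_{n+1}·i + f_{n+2}·j + f_{n+3}·k` in `ℍ[R] = H(-1,-1)`. -/
def fibQuat (R : Type*) [CommRing R] (n : ℕ) : ℍ[R] :=
  ⟨(Nat.fib n : R), (Nat.fib (n + 1) : R), (Nat.fib (n + 2) : R), (Nat.fib (n + 3) : R)⟩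

lemma normSq_fibQuat (R : Type*) [CommRing R] (n : ℕ) :
    Quaternion.normSq (fibQuat R n) = 3 * (Nat.fib (2 * n + 3) : R) := by
  have h : Nat.fib (2 * n + 3) = Nat.fib (n + 1) ^ 2 + Nat.fib (n + 2) ^ 2 := by
    rw [show 2 * n + 3 = 2 * (n + 1) + 1 by ring, Nat.fib_two_mul_add_one]
    ring
  rw [h, Quaternion.normSq_def']
  simp only [fibQuat, Nat.fib_add_two (n := n), Nat.fib_add_two (n := n + 1)]
  push_cast
  ring

lemma Quaternion.isUnit_iff_isUnit_normSq {R : Type*} [CommRing R] (x : ℍ[R]) :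
    IsUnit x ↔ IsUnit (normSq x) := by
  refine ⟨fun h => h.map normSq, fun h => ?_⟩
  obtain ⟨c, hc⟩ := h.exists_right_inv
  have h₁ : x * (star x * (c : ℍ[R])) = 1 := by
    rw [← mul_assoc, self_mul_star, ← coe_mul, hc, coe_one]
  have h₂ : (c : ℍ[R]) * star x * x = 1 := by
    rw [mul_assoc, star_mul_self, ← coe_mul, mul_comm, hc, coe_one]
  exact ⟨⟨x, star x * c, h₁, by rwa [← coe_commutes c (star x)]⟩, rfl⟩

lemma Nat.fib_sq_succ_sub_cast {R : Type*} [CommRing R] (n : ℕ) :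
    (fib (n + 1) : R) ^ 2 - fib n * fib (n + 1) - (fib n : R) ^ 2 = (-1) ^ n := by
  induction n with
  | zero => simp
  | succ n ih =>
    rw [pow_succ (-1 : R), ← ih, Nat.fib_add_two (n := n)]
    push_cast
    ring

lemma Nat.fib_add_cast_of_fib_eq_zero {R : Type*} [CommRing R] {z : ℕ}
    (hz : (fib z : R) = 0) (n : ℕ) : (fib (n + z) : R) = fib (z + 1) * fib n := by
  cases n with
  | zero => simp [hz]
  | succ n =>
    rw [show n + 1 + z = z + n + 1 by ring, Nat.fib_add]
    push_cast
    rw [hz]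
    ring

lemma Nat.fib_add_mul_cast_of_fib_eq_zero {R : Type*} [CommRing R] {z : ℕ}
    (hz : (fib z : R) = 0) (n m : ℕ) :
    (fib (n + z * m) : R) = (fib (z + 1) : R) ^ m * fib n := by
  induction m with
  | zero => simp
  | succ m ih =>
    rw [show n + z * (m + 1) = n + z * m + z by ring, fib_add_cast_of_fib_eq_zero hz, ih]
    ring

lemma Nat.fib_cast_of_shift_eq {R : Type*} [CommRing R] (d a : ℕ)
    (h₀ : (fib (a + d) : R) = fib a) (h₁ : (fib (a + 1 + d) : R) = fib (a + 1)) :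
    (fib d : R) = 0 ∧ (fib (d + 1) : R) = 1 := by
  induction a with
  | zero => simpa [add_comm] using And.intro h₀ h₁
  | succ a ih =>
    refine ih ?_ h₀
    rw [show a + 1 + 1 + d = a + d + 2 by ring, fib_add_two, fib_add_two,
      show a + d + 1 = a + 1 + d by ring] at h₁
    push_cast at h₁
    linear_combination h₁ - h₀

lemma Nat.dvd_fib_iff_of_isLeast {p z : ℕ} (hz : IsLeast {m | 0 < m ∧ p ∣ fib m} z) (m : ℕ) :
    p ∣ fib m ↔ z ∣ m := by
  refine ⟨fun h => ?_, fun h => hz.1.2.trans (fib_dvd _ _ h)⟩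
  have hle : z ≤ gcd z m :=
    hz.2 ⟨gcd_pos_of_pos_left _ hz.1.1, by rw [fib_gcd]; exact dvd_gcd hz.1.2 h⟩
  exact (le_antisymm (le_of_dvd hz.1.1 (gcd_dvd_left z m)) hle) ▸ gcd_dvd_right z m

lemma pisano_eq_four_mul_of_odd {p : ℕ} (hp : p.Prime) (hp2 : 2 < p)
    {z : ℕ} (hz : IsLeast {m | 0 < m ∧ p ∣ Nat.fib m} z) (hzodd : Odd z) {k : ℕ}
    (hk : IsLeast {m | 0 < m ∧ (Nat.fib m : ZMod p) = 0 ∧ (Nat.fib (m + 1) : ZMod p) = 1} k) :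
    k = 4 * z := by
  have := Fact.mk hp
  have : Fact (2 < p) := ⟨hp2⟩
  have hz0 : (Nat.fib z : ZMod p) = 0 := (ZMod.natCast_eq_zero_iff _ _).2 hz.1.2
  have hsq : (Nat.fib (z + 1) : ZMod p) ^ 2 = -1 := by
    simpa [hz0, hzodd.neg_one_pow] using Nat.fib_sq_succ_sub_cast (R := ZMod p) z
  have hfour : (Nat.fib (z + 1) : ZMod p) ^ 4 = 1 := by
    linear_combination (Nat.fib (z + 1) ^ 2 - 1 : ZMod p) * hsq
  have hle : k ≤ z * 4 := by
    refine hk.2 ⟨by have := hz.1.1; omega, ?_, ?_⟩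
    · simpa using Nat.fib_add_mul_cast_of_fib_eq_zero hz0 0 4
    · rw [add_comm, Nat.fib_add_mul_cast_of_fib_eq_zero hz0, hfour]
      simp
  obtain ⟨hk0, hfk, hfk1⟩ := hk.1
  obtain ⟨m, rfl⟩ := (Nat.dvd_fib_iff_of_isLeast hz k).1 ((ZMod.natCast_eq_zero_iff _ _).1 hfk)
  rw [add_comm, Nat.fib_add_mul_cast_of_fib_eq_zero hz0, Nat.fib_one, Nat.cast_one, mul_one]
    at hfk1
  have hm : m ≤ 4 := Nat.le_of_mul_le_mul_left hle hz.1.1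
  have hneg : (-1 : ZMod p) ≠ 1 := ZMod.neg_one_ne_one
  interval_cases m
  · simp at hk0
  · exact absurd (by rw [← hsq, ← pow_one (Nat.fib (z + 1) : ZMod p), hfk1, one_pow]) hneg
  · exact absurd (hsq.symm.trans hfk1) hneg
  · refine absurd ?_ hneg
    have h1 : (Nat.fib (z + 1) : ZMod p) = 1 := by
      linear_combination hfour - (Nat.fib (z + 1) : ZMod p) * hfk1
    rw [← hsq, h1, one_pow]
  · ring

lemma range_fibQuat_eq_image {R : Type*} [CommRing R] {k : ℕ} (hk0 : 0 < k)
    (hfk : (Nat.fib k : R) = 0) (hfk1 : (Nat.fib (k + 1) : R) = 1) :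
    Set.range (fibQuat R) = fibQuat R '' (Finset.range k : Set ℕ) := by
  refine Set.Subset.antisymm ?_ (Set.image_subset_range _ _)
  rintro _ ⟨n, rfl⟩
  refine ⟨n % k, by simpa using Nat.mod_lt n hk0, ?_⟩
  have h (c : ℕ) : (Nat.fib (n + c) : R) = Nat.fib (n % k + c) := by
    conv_lhs => rw [← Nat.mod_add_div n k, add_right_comm,
      Nat.fib_add_mul_cast_of_fib_eq_zero hfk, hfk1, one_pow, one_mul]
  ext
  exacts [(h 0).symm, (h 1).symm, (h 2).symm, (h 3).symm]

lemma injOn_fibQuat_range {R : Type*} [CommRing R] {k : ℕ}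
    (hk : k ∈ lowerBounds {m | 0 < m ∧ (Nat.fib m : R) = 0 ∧ (Nat.fib (m + 1) : R) = 1}) :
    Set.InjOn (fibQuat R) (Finset.range k : Set ℕ) := by
  intro a ha b hb hab
  wlog hle : a ≤ b generalizing a b
  · exact (this hb ha hab.symm (le_of_not_ge hle)).symm
  obtain ⟨d, rfl⟩ := Nat.exists_eq_add_of_le hle
  have h₀ : (Nat.fib (a + d) : R) = Nat.fib a := (congrArg QuaternionAlgebra.re hab).symm
  have h₁ : (Nat.fib (a + 1 + d) : R) = Nat.fib (a + 1) := by
    rw [add_right_comm]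
    exact (congrArg QuaternionAlgebra.imI hab).symm
  by_contra hne
  have hd : k ≤ d := hk ⟨by omega, Nat.fib_cast_of_shift_eq d a h₀ h₁⟩
  simp only [Finset.coe_range, Set.mem_Iio] at hb
  omega

lemma card_filter_dvd_two_mul_add_three {z : ℕ} (hzodd : Odd z) (hz1 : 1 < z) :
    ((Finset.range (4 * z)).filter (fun n => z ∣ 2 * n + 3)).card = 4 := by
  obtain ⟨w, rfl⟩ := hzodd
  have h : (Finset.range (4 * (2 * w + 1))).filter (fun n => 2 * w + 1 ∣ 2 * n + 3) =
      (Finset.range 4).image (fun j => w - 1 + j * (2 * w + 1)) := by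
    ext n
    simp only [Finset.mem_filter, Finset.mem_range, Finset.mem_image]
    constructor
    · rintro ⟨hn, c, hc⟩
      have hc9 : c < 9 := by
        by_contra! h
        have := Nat.mul_le_mul_left (2 * w + 1) h
        omega
      refine ⟨c / 2, ?_⟩
      interval_cases c <;> omega
    · rintro ⟨j, hj, rfl⟩
      refine ⟨by interval_cases j <;> omega, 2 * j + 1, ?_⟩
      obtain ⟨v, rfl⟩ : ∃ v, w = v + 1 := ⟨w - 1, by omega⟩
      rw [Nat.add_sub_cancel]
      ring
  rw [h, Finset.card_image_of_injective, Finset.card_range]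
  intro a b hab
  exact Nat.eq_of_mul_eq_mul_right (by omega) (Nat.add_left_cancel hab)

theorem fibQuat_zmod_p_count (p : ℕ) (hp : p.Prime) (hp5 : 5 < p)
    (z : ℕ) (hz : IsLeast {m | 0 < m ∧ p ∣ Nat.fib m} z) (hzodd : Odd z)
    (k : ℕ)
    (hk : IsLeast {m | 0 < m ∧ (Nat.fib m : ZMod p) = 0 ∧ (Nat.fib (m + 1) : ZMod p) = 1} k) :
    {x ∈ Set.range (fibQuat (ZMod p)) | ¬ IsUnit x}.ncard = 4 ∧
    {x ∈ Set.range (fibQuat (ZMod p)) | IsUnit x}.ncard = k - 4 := by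
  have := Fact.mk hp
  obtain ⟨hk0, hfk, hfk1⟩ := hk.1
  have hk4 : k = 4 * z := pisano_eq_four_mul_of_odd hp (by omega) hz hzodd hk
  have hz1 : 1 < z := by
    refine lt_of_le_of_ne hz.1.1 ?_
    rintro rfl
    exact hp.one_lt.ne' (Nat.dvd_one.1 (by simpa using hz.1.2))
  have h3 : (3 : ZMod p) ≠ 0 := by
    intro h
    have := Nat.le_of_dvd (by norm_num) ((ZMod.natCast_eq_zero_iff 3 p).1 (by exact_mod_cast h))
    omega
  have hunit (n : ℕ) : IsUnit (fibQuat (ZMod p) n) ↔ ¬ z ∣ 2 * n + 3 := by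
    rw [Quaternion.isUnit_iff_isUnit_normSq, normSq_fibQuat, isUnit_iff_ne_zero, mul_ne_zero_iff,
      Ne, Ne, ZMod.natCast_eq_zero_iff, Nat.dvd_fib_iff_of_isLeast hz]
    exact and_iff_right h3
  have hinj := injOn_fibQuat_range hk.2
  have hcount (P : ℍ[ZMod p] → Prop) (Q : ℕ → Prop) [DecidablePred Q]
      (hPQ : ∀ n, P (fibQuat (ZMod p) n) ↔ Q n) :
      {x ∈ Set.range (fibQuat (ZMod p)) | P x}.ncard = ((Finset.range k).filter Q).card := by
    have himage : {x ∈ Set.range (fibQuat (ZMod p)) | P x} =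
        fibQuat (ZMod p) '' ((Finset.range k).filter Q : Set ℕ) := by
      rw [range_fibQuat_eq_image hk0 hfk hfk1]
      ext x
      simp only [Set.mem_image, Finset.mem_coe, Finset.mem_filter, Set.mem_ofPred_eq]
      constructor
      · rintro ⟨⟨n, hn, rfl⟩, hP⟩
        exact ⟨n, ⟨hn, (hPQ n).1 hP⟩, rfl⟩
      · rintro ⟨n, ⟨hn, hQ⟩, rfl⟩
        exact ⟨⟨n, hn, rfl⟩, (hPQ n).2 hQ⟩
    rw [himage, Set.InjOn.ncard_image
      (hinj.mono (Finset.coe_subset.2 (Finset.filter_subset _ _))), Set.ncard_coe_finset]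
  have hfour : ((Finset.range k).filter (fun n => z ∣ 2 * n + 3)).card = 4 :=
    hk4 ▸ card_filter_dvd_two_mul_add_three hzodd hz1
  have hsum := Finset.card_filter_add_card_filter_not (s := Finset.range k)
    (fun n => z ∣ 2 * n + 3)
  rw [hfour, Finset.card_range] at hsum
  rw [hcount _ (fun n => z ∣ 2 * n + 3) (fun n => by rw [hunit, not_not]),
    hcount _ (fun n => ¬ z ∣ 2 * n + 3) hunit]
  exact ⟨hfour, by omega⟩
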